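/- Let P be a polynomial with complex coefficients of degree n having no zeros in the open unit disk {z : |z| < 1}, let Q(z) = z^n · conj(P(1/conj(z))) be its conjugate-reciprocal polynomial, and let a be a complex number with |a| ≤ 1. Then for every complex z with |z| ≥ 1, |S̃_a[P](z)| ≤ |S̃_a[Q](z)|. -/

import Mathlib

open Polynomial

/-- The modified Smirnov operator: S̃ₐ[P](z) = (1+az)·P′(z) − n·a·P(z). -/
noncomputable def smirnov (n : ℕ) (a : ℂ) (P : Polynomial ℂ) (z : ℂ) : ℂ :=
  (1 + a * z) * P.derivative.eval z - (n : ℂ) * a * P.eval z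

/-- The maximum of ‖P‖ on the unit circle. -/
noncomputable def maxCircle (P : Polynomial ℂ) : ℝ :=
  sSup {y : ℝ | ∃ w : ℂ, ‖w‖ = 1 ∧ y = ‖P.eval w‖}

lemma norm_sub_le_norm_one_sub_conj_mul {z r : ℂ} (hz : 1 ≤ ‖z‖) (hr : 1 ≤ ‖r‖) :
    ‖z - r‖ ≤ ‖1 - (starRingEnd ℂ) z * r‖ := by
  have h1 : 1 ≤ Complex.normSq z := by rw [Complex.normSq_eq_norm_sq]; nlinarith
  have h2 : 1 ≤ Complex.normSq r := by rw [Complex.normSq_eq_norm_sq]; nlinarith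
  refine le_of_pow_le_pow_left₀ two_ne_zero (norm_nonneg _) ?_
  rw [← Complex.normSq_eq_norm_sq, ← Complex.normSq_eq_norm_sq]
  simp only [Complex.normSq_apply, Complex.sub_re, Complex.sub_im, Complex.mul_re, Complex.mul_im,
    Complex.conj_re, Complex.conj_im, Complex.one_re, Complex.one_im] at *
  nlinarith [mul_nonneg (sub_nonneg.2 h1) (sub_nonneg.2 h2)]

lemma norm_conj_mul_sub_one_le_norm_sub {z g : ℂ} (hz : 1 ≤ ‖z‖) (hg : ‖g‖ ≤ 1) :
    ‖(starRingEnd ℂ) z * g - 1‖ ≤ ‖z - g‖ := by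
  have h1 : 1 ≤ Complex.normSq z := by rw [Complex.normSq_eq_norm_sq]; nlinarith
  have h2 : Complex.normSq g ≤ 1 := by
    rw [Complex.normSq_eq_norm_sq]; nlinarith [norm_nonneg g]
  refine le_of_pow_le_pow_left₀ two_ne_zero (norm_nonneg _) ?_
  rw [← Complex.normSq_eq_norm_sq, ← Complex.normSq_eq_norm_sq]
  simp only [Complex.normSq_apply, Complex.sub_re, Complex.sub_im, Complex.mul_re, Complex.mul_im,
    Complex.conj_re, Complex.conj_im, Complex.one_re, Complex.one_im] at *
  nlinarith [mul_nonneg (sub_nonneg.2 h1) (sub_nonneg.2 h2)]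

lemma norm_one_add_mul_lt_norm_add_conj {z a : ℂ} (hz : 1 < ‖z‖) (ha : ‖a‖ < 1) :
    ‖1 + a * z‖ < ‖a + (starRingEnd ℂ) z‖ := by
  have h1 : 1 < Complex.normSq z := by rw [Complex.normSq_eq_norm_sq]; nlinarith
  have h2 : Complex.normSq a < 1 := by
    rw [Complex.normSq_eq_norm_sq]; nlinarith [norm_nonneg a]
  refine lt_of_pow_lt_pow_left₀ 2 (norm_nonneg _) ?_
  rw [← Complex.normSq_eq_norm_sq, ← Complex.normSq_eq_norm_sq]
  simp only [Complex.normSq_apply, Complex.add_re, Complex.add_im, Complex.mul_re, Complex.mul_im,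
    Complex.conj_re, Complex.conj_im, Complex.one_re, Complex.one_im] at *
  nlinarith [mul_pos (sub_pos.2 h1) (sub_pos.2 h2)]

lemma norm_multiset_sum_sub_card_mul_le (s : Multiset ℂ) (k w : ℂ) (f : ℂ → ℂ)
    (h : ∀ g ∈ s, ‖k * f g - w‖ ≤ 1) :
    ‖k * (s.map f).sum - s.card * w‖ ≤ s.card := by
  induction s using Multiset.induction_on with
  | empty => simp
  | cons g s ih =>
    have h1 := ih fun x hx => h x (Multiset.mem_cons_of_mem hx)
    have h2 := h g (Multiset.mem_cons_self g s)
    simp only [Multiset.map_cons, Multiset.sum_cons, Multiset.card_cons, Nat.cast_add,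
      Nat.cast_one]
    calc _ = ‖(k * (s.map f).sum - s.card * w) + (k * f g - w)‖ := by congr 1; ring
      _ ≤ _ := (norm_add_le _ _).trans (add_le_add h1 h2)

/-- A form of Laguerre's theorem: if all zeros of `G` lie in the closed unit disk, then
`smirnov` of `G` has no zeros outside it when `‖a‖ < 1`. -/
lemma smirnov_ne_zero {n : ℕ} (hn : 0 < n) {G : ℂ[X]} (hG : G.natDegree = n)
    (hroots : ∀ w : ℂ, 1 < ‖w‖ → G.eval w ≠ 0) {a z : ℂ} (ha : ‖a‖ < 1) (hz : 1 < ‖z‖) :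
    smirnov n a G z ≠ 0 := by
  intro h0
  have hGz := hroots z hz
  have hsplit := IsAlgClosed.splits G
  have hcard : G.roots.card = n := by rw [← hG]; exact hsplit.natDegree_eq_card_roots.symm
  have hne : G ≠ 0 := by rintro rfl; simp at hGz
  have hsum : G.derivative.eval z / G.eval z = (G.roots.map fun g => 1 / (z - g)).sum :=
    hsplit.eval_derivative_div_eval_of_ne_zero hGz
  set V := (G.roots.map fun g => 1 / (z - g)).sum with hV
  have hder : G.derivative.eval z = V * G.eval z := by rw [← hsum]; field_simp
  have hlin : (1 + a * z) * V = n * a := by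
    rw [smirnov, hder] at h0
    refine mul_right_cancel₀ hGz ?_
    linear_combination h0
  have hbound := norm_multiset_sum_sub_card_mul_le G.roots (z * (starRingEnd ℂ) z - 1)
    ((starRingEnd ℂ) z) (fun g => 1 / (z - g)) (by
      intro g hg
      have hg1 : ‖g‖ ≤ 1 := by
        by_contra! hlt
        exact hroots g hlt (isRoot_of_mem_roots hg)
      have hzg : z - g ≠ 0 := by
        intro h
        rw [sub_eq_zero.1 h] at hz
        linarith
      have : (z * (starRingEnd ℂ) z - 1) * (1 / (z - g)) - (starRingEnd ℂ) z
          = ((starRingEnd ℂ) z * g - 1) / (z - g) := by field_simp; ring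
      rw [this, norm_div]
      exact div_le_one_of_le₀ (norm_conj_mul_sub_one_le_norm_sub hz.le hg1) (norm_nonneg _))
  rw [← hV, hcard] at hbound
  have hmul : ‖1 + a * z‖ * ‖(z * (starRingEnd ℂ) z - 1) * V - n * (starRingEnd ℂ) z‖
      = n * ‖a + (starRingEnd ℂ) z‖ := by
    rw [← norm_mul, ← Complex.norm_natCast n, ← norm_mul, ← norm_neg]
    congr 1
    linear_combination (-(z * (starRingEnd ℂ) z - 1)) * hlin
  have h1 := mul_le_mul_of_nonneg_left hbound (norm_nonneg (1 + a * z))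
  have h2 := norm_one_add_mul_lt_norm_add_conj hz ha
  have hn' : (0 : ℝ) < n := by exact_mod_cast hn
  rw [hmul] at h1
  nlinarith

lemma norm_eval_eq_prod_roots (P : ℂ[X]) (z : ℂ) :
    ‖P.eval z‖ = ‖P.leadingCoeff‖ * (P.roots.map fun r => ‖z - r‖).prod := by
  conv_lhs => rw [(IsAlgClosed.splits P).eq_prod_roots]
  rw [eval_mul, eval_C, norm_mul, eval_multiset_prod, Multiset.map_map]
  congr 1
  induction P.roots using Multiset.induction_on with
  | empty => simp
  | cons r s ih =>
    rw [Multiset.map_cons, Multiset.prod_cons, Multiset.map_cons, Multiset.prod_cons, norm_mul, ih]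
    simp

lemma eval_sum_conj_coeff_reflect (P : ℂ[X]) {z : ℂ} (hz : z ≠ 0) :
    (∑ k ∈ Finset.range (P.natDegree + 1),
      C ((starRingEnd ℂ) (P.coeff (P.natDegree - k))) * X ^ k).eval z
      = z ^ P.natDegree * (starRingEnd ℂ) (P.eval ((starRingEnd ℂ) z)⁻¹) := by
  rw [P.eval_eq_sum_range, map_sum, Finset.mul_sum, eval_finsetSum, ← Finset.sum_range_reflect]
  refine Finset.sum_congr rfl fun k hk => ?_
  have hk' : k ≤ P.natDegree := Nat.lt_succ_iff.1 (Finset.mem_range.1 hk)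
  have e1 : P.natDegree + 1 - 1 - k = P.natDegree - k := by omega
  have e2 : P.natDegree - (P.natDegree - k) = k := by omega
  have hpow : z ^ P.natDegree = z ^ (P.natDegree - k) * z ^ k := by
    rw [← pow_add]; congr 1; omega
  simp only [e1, e2, eval_mul, eval_C, eval_pow, eval_X, map_mul, map_pow, map_inv₀,
    Complex.conj_conj, hpow, inv_pow]
  field_simp

lemma norm_eval_le_norm_pow_mul_eval_inv_conj {P : ℂ[X]}
    (hP : ∀ w : ℂ, ‖w‖ < 1 → P.eval w ≠ 0) {z : ℂ} (hz : 1 ≤ ‖z‖) :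
    ‖P.eval z‖ ≤ ‖z ^ P.natDegree * (starRingEnd ℂ) (P.eval ((starRingEnd ℂ) z)⁻¹)‖ := by
  have hz0 : (starRingEnd ℂ) z ≠ 0 := by
    rw [_root_.map_ne_zero]; rintro rfl; norm_num at hz
  have hr : ∀ r ∈ P.roots, 1 ≤ ‖r‖ := fun r h => by
    by_contra! hlt
    exact hP r hlt (isRoot_of_mem_roots h)
  rw [norm_mul, Complex.norm_conj, norm_eval_eq_prod_roots, norm_eval_eq_prod_roots P (_)⁻¹,
    mul_left_comm, norm_pow]
  refine mul_le_mul_of_nonneg_left ?_ (norm_nonneg _)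
  rw [(IsAlgClosed.splits P).natDegree_eq_card_roots, ← Multiset.prod_replicate,
    ← Multiset.map_const', ← Multiset.prod_map_mul]
  refine Multiset.prod_map_le_prod_map₀ _ _ (fun _ _ => norm_nonneg _) fun r h => ?_
  refine (norm_sub_le_norm_one_sub_conj_mul hz (hr r h)).trans_eq ?_
  rw [← Complex.norm_conj z, ← norm_mul]
  congr 1
  field_simp

lemma norm_leadingCoeff_le_norm_coeff_zero {P : ℂ[X]}
    (hP : ∀ w : ℂ, ‖w‖ < 1 → P.eval w ≠ 0) : ‖P.leadingCoeff‖ ≤ ‖P.coeff 0‖ := by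
  rw [coeff_zero_eq_eval_zero, norm_eval_eq_prod_roots]
  refine le_mul_of_one_le_right (norm_nonneg _) ?_
  have h := Multiset.prod_map_le_prod_map₀ (s := P.roots) (fun _ => (1 : ℝ)) (fun r => ‖0 - r‖)
    (fun _ _ => zero_le_one) fun r h => by
      rw [zero_sub, norm_neg]
      by_contra! hlt
      exact hP r hlt (isRoot_of_mem_roots h)
  simpa using h

lemma norm_smirnov_le_of_lt (n : ℕ) (P Q : Polynomial ℂ) (hP : P.natDegree = n)
    (hP0 : ∀ w : ℂ, ‖w‖ < 1 → P.eval w ≠ 0)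
    (hQ : Q = ∑ k ∈ Finset.range (n + 1),
        Polynomial.C ((starRingEnd ℂ) (P.coeff (n - k))) * Polynomial.X ^ k)
    (a : ℂ) (ha : ‖a‖ < 1) (z : ℂ) (hz : 1 < ‖z‖) :
    ‖smirnov n a P z‖ ≤ ‖smirnov n a Q z‖ := by
  rcases Nat.eq_zero_or_pos n with hn | hn
  · subst hn
    simp only [smirnov, derivative_of_natDegree_zero hP, eval_zero, mul_zero, Nat.cast_zero, zero_mul,
      sub_zero, norm_zero]
    exact norm_nonneg _
  have hQeval : ∀ w : ℂ, 1 < ‖w‖ →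
      Q.eval w = w ^ P.natDegree * (starRingEnd ℂ) (P.eval ((starRingEnd ℂ) w)⁻¹) := by
    intro w hw
    rw [hQ, ← hP]
    exact eval_sum_conj_coeff_reflect P (by rintro rfl; norm_num at hw)
  have hQ0 : ∀ w : ℂ, 1 < ‖w‖ → Q.eval w ≠ 0 := by
    intro w hw
    rw [hQeval w hw]
    refine mul_ne_zero (pow_ne_zero _ (by rintro rfl; norm_num at hw)) ?_
    rw [_root_.map_ne_zero]
    refine hP0 _ ?_
    rw [norm_inv, Complex.norm_conj]
    exact inv_lt_one_of_one_lt₀ hw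
  have hPQ : ∀ w : ℂ, 1 < ‖w‖ → ‖P.eval w‖ ≤ ‖Q.eval w‖ := fun w hw => by
    rw [hQeval w hw]
    exact norm_eval_le_norm_pow_mul_eval_inv_conj hP0 hw.le
  have hQdeg : Q.natDegree ≤ n := by
    rw [hQ]
    refine natDegree_sum_le_of_forall_le _ _ fun k hk => ?_
    exact (natDegree_C_mul_X_pow_le _ _).trans (Nat.lt_succ_iff.1 (Finset.mem_range.1 hk))
  have hQn : Q.coeff n = (starRingEnd ℂ) (P.coeff 0) := by
    rw [hQ]
    simp [finsetSum_coeff, coeff_C_mul, coeff_X_pow]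
  have hP00 : P.coeff 0 ≠ 0 := by
    rw [coeff_zero_eq_eval_zero]; exact hP0 0 (by simp)
  have hQn0 : Q.coeff n ≠ 0 := by rwa [hQn, _root_.map_ne_zero]
  have hlead : ‖P.coeff n‖ ≤ ‖Q.coeff n‖ := by
    rw [hQn, Complex.norm_conj, ← hP]
    exact norm_leadingCoeff_le_norm_coeff_zero hP0
  have hSQ : smirnov n a Q z ≠ 0 :=
    smirnov_ne_zero hn (natDegree_eq_of_le_of_coeff_ne_zero hQdeg hQn0) hQ0 ha hz
  by_contra! hlt
  set c := smirnov n a P z / smirnov n a Q z with hc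
  have hc1 : 1 < ‖c‖ := by
    rw [hc, norm_div]
    exact (one_lt_div (norm_pos_iff.2 hSQ)).2 hlt
  have key : ∀ x y : ℂ, ‖x‖ ≤ ‖y‖ → y ≠ 0 → x - c * y ≠ 0 := by
    intro x y hxy hy h
    rw [sub_eq_zero.1 h, norm_mul] at hxy
    nlinarith [norm_pos_iff.2 hy]
  refine smirnov_ne_zero hn (G := P - C c * Q)
    (natDegree_eq_of_le_of_coeff_ne_zero ?_ ?_) ?_ ha hz ?_
  · exact (max_self n) ▸ natDegree_sub_le_of_le hP.le ((natDegree_C_mul_le _ _).trans hQdeg)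
  · rw [coeff_sub, coeff_C_mul]
    exact key _ _ hlead hQn0
  · intro w hw
    rw [eval_sub, eval_C_mul]
    exact key _ _ (hPQ w hw) (hQ0 w hw)
  · have h : c * smirnov n a Q z = smirnov n a P z := div_mul_cancel₀ _ hSQ
    simp only [smirnov, derivative_sub, derivative_C_mul, eval_sub, eval_C_mul] at h ⊢
    linear_combination -h

theorem statement11 (n : ℕ) (P Q : Polynomial ℂ) (hP : P.natDegree = n)
    (hP0 : ∀ w : ℂ, ‖w‖ < 1 → P.eval w ≠ 0)
    (hQ : Q = ∑ k ∈ Finset.range (n + 1),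
        Polynomial.C ((starRingEnd ℂ) (P.coeff (n - k))) * Polynomial.X ^ k)
    (a : ℂ) (ha : ‖a‖ ≤ 1) (z : ℂ) (hz : 1 ≤ ‖z‖) :
    ‖smirnov n a P z‖ ≤ ‖smirnov n a Q z‖ := by
  have hcont : ∀ R : ℂ[X], Filter.Tendsto
      (fun t : ℝ => ‖smirnov n (((1 - t : ℝ) : ℂ) * a) R (((1 + t : ℝ) : ℂ) * z)‖)
      (nhdsWithin 0 (Set.Ioo 0 1)) (nhds ‖smirnov n a R z‖) := by
    intro R
    have hc : Continuous fun t : ℝ =>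
        ‖smirnov n (((1 - t : ℝ) : ℂ) * a) R (((1 + t : ℝ) : ℂ) * z)‖ := by
      unfold smirnov
      fun_prop
    have := hc.tendsto 0
    simp only [sub_zero, add_zero, Complex.ofReal_one, one_mul] at this
    exact this.mono_left nhdsWithin_le_nhds
  have : (nhdsWithin (0 : ℝ) (Set.Ioo 0 1)).NeBot := left_nhdsWithin_Ioo_neBot one_pos
  refine le_of_tendsto_of_tendsto (hcont P) (hcont Q) ?_
  filter_upwards [self_mem_nhdsWithin] with t ht
  refine norm_smirnov_le_of_lt n P Q hP hP0 hQ _ ?_ _ ?_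
  · rw [norm_mul, Complex.norm_real, Real.norm_of_nonneg (by linarith [ht.2])]
    nlinarith [ht.1, ht.2, norm_nonneg a]
  · rw [norm_mul, Complex.norm_real, Real.norm_of_nonneg (by linarith [ht.1])]
    nlinarith [ht.1, ht.2]
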